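/- Assume in addition that φ is symmetric, φ(−y) = φ(y), with support contained in (−J,J) for some J > 0, and that a < b ≤ 0. Let v be the classical solution of the boundary value problem 𝓛v − 𝓘v = f on (a,b), v = 0 outside (a,b), with f(x) = −μx. Then v'(b) < 0. In particular, if (u, b*) with b* > a solves the free boundary problem — u(x) = x for x ∉ (a,b*), u ∈ C² on (a,b*) with (σ²/2)u''(x) − μxu'(x) + λ∫_ℝ(u(x+y) − u(x))φ(y) dy = 0 for x ∈ (a,b*), and u'(b*) = 1 — then b* > 0. -/

import Mathlib

open MeasureTheory

/-- The integral operator `𝓘v(x) = λ(∫_a^b φ(x−y) v(y) dy − v(x))`. -/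
noncomputable def Iop (a b lam : ℝ) (φ v : ℝ → ℝ) : ℝ → ℝ :=
  fun x => lam * ((∫ y in a..b, φ (x - y) * v y) - v x)

/-- `v` is a classical solution of the boundary value problem `𝓛v − 𝓘v = f` on `(a,b)`,
`v = 0` outside `(a,b)`, where `𝓛v = −(σ²/2)v'' + μxv'`. -/
def IsClassicalSolution (a b σ μ lam : ℝ) (φ f v : ℝ → ℝ) : Prop :=
  (∀ x, x ∉ Set.Ioo a b → v x = 0) ∧
  ContDiffOn ℝ 2 v (Set.Icc a b) ∧
  ∀ x ∈ Set.Ioo a b,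
    -(σ ^ 2 / 2) * deriv (deriv v) x + μ * x * deriv v x - Iop a b lam φ v x = f x

lemma IsLocalMin.deriv_deriv_nonneg {f : ℝ → ℝ} {x : ℝ} (h : IsLocalMin f x)
    (hc : ContinuousAt f x) : 0 ≤ deriv (deriv f) x := by
  by_contra! hneg
  have hmax := isLocalMax_of_deriv_deriv_neg hneg h.deriv_eq_zero hc
  have hconst : f =ᶠ[nhds x] fun _ => f x := by
    filter_upwards [h, hmax] with y h1 h2 using le_antisymm h2 h1
  have hd : deriv f =ᶠ[nhds x] fun _ => 0 := by
    simpa using hconst.deriv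
  rw [hd.deriv_eq] at hneg
  simp at hneg

/-- A continuous function that is nonnegative at the endpoints and has no nonpositive interior
minimum is positive inside. -/
lemma pos_of_no_nonpos_interior_min {z : ℝ → ℝ} {c d : ℝ}
    (hz : ContinuousOn z (Set.Icc c d)) (hzc : 0 ≤ z c) (hzd : 0 ≤ z d)
    (hmin : ∀ x ∈ Set.Ioo c d, z x ≤ 0 → IsMinOn z (Set.Icc c d) x → False) :
    ∀ x ∈ Set.Ioo c d, 0 < z x := by
  intro x hx
  by_contra! hxz
  obtain ⟨m, hm, hmm⟩ := isCompact_Icc.exists_isMinOn ⟨x, Set.Ioo_subset_Icc_self hx⟩ hz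
  have hmx : z m ≤ z x := hmm (Set.Ioo_subset_Icc_self hx)
  by_cases hmI : m ∈ Set.Ioo c d
  · exact hmin m hmI (hmx.trans hxz) hmm
  · have hm0 : 0 ≤ z m := by
      rcases eq_or_lt_of_le hm.1 with h | h
      · rwa [← h]
      rcases eq_or_lt_of_le hm.2 with h' | h'
      · rwa [h']
      exact absurd ⟨h, h'⟩ hmI
    refine hmin x hx hxz fun y hy => ?_
    have hmy : z m ≤ z y := hmm hy
    exact (hxz.trans hm0).trans hmy

lemma ContDiffOn.differentiableAt_and_deriv_of_Ioo {v : ℝ → ℝ} {a b x : ℝ} (hv : ContDiffOn ℝ 2 v (Set.Ioo a b))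
    (hx : x ∈ Set.Ioo a b) : DifferentiableAt ℝ v x ∧ DifferentiableAt ℝ (deriv v) x := by
  have hn := isOpen_Ioo.mem_nhds hx
  have h1 : ContDiffOn ℝ 1 (deriv v) (Set.Ioo a b) :=
    ((contDiffOn_succ_iff_deriv_of_isOpen (n := 1) isOpen_Ioo).1 (by norm_num; exact hv)).2.2
  exact ⟨(hv.differentiableOn (by norm_num)).differentiableAt hn,
    (h1.differentiableOn (by norm_num)).differentiableAt hn⟩

lemma le_intervalIntegral_mul_of_isMinOn {a b x : ℝ} (hab : a < b) {φ v : ℝ → ℝ}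
    (hφc : Continuous φ) (hφ0 : ∀ y, 0 ≤ φ y) (hφ1 : (∫ y, φ y) = 1)
    (hv : ContinuousOn v (Set.Icc a b)) (hx : v x ≤ 0) (hmin : IsMinOn v (Set.Icc a b) x) :
    v x ≤ ∫ y in a..b, φ (x - y) * v y := by
  have hφi : Integrable φ := by
    by_contra h
    rw [integral_undef h] at hφ1
    norm_num at hφ1
  have hle : (∫ y in a..b, φ (x - y)) ≤ 1 := by
    rw [intervalIntegral.integral_of_le hab.le, ← hφ1, ← integral_sub_left_eq_self φ volume x]
    exact setIntegral_le_integral (hφi.comp_sub_left x) (.of_forall fun y => hφ0 _)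
  have hcont : ContinuousOn (fun y => φ (x - y)) (Set.uIcc a b) := by fun_prop
  have hmono : (∫ y in a..b, φ (x - y) * v x) ≤ ∫ y in a..b, φ (x - y) * v y := by
    refine intervalIntegral.integral_mono_on hab.le ?_ ?_ fun y hy =>
      mul_le_mul_of_nonneg_left (hmin hy) (hφ0 _)
    · exact (hcont.mul continuousOn_const).intervalIntegrable
    · exact (hcont.mul (by rwa [Set.uIcc_of_le hab.le])).intervalIntegrable
  rw [intervalIntegral.integral_mul_const] at hmono
  nlinarith

/-- Maximum principle and Hopf lemma for `𝓛v − 𝓘v = −μx` on `(a,b)` with `b ≤ 0`: near `b`, the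
solution lies above a linear function decreasing to zero. -/
lemma exists_linear_lower_bound {a b σ μ lam : ℝ} (hab : a < b) (hb : b ≤ 0)
    (hσ : 0 < σ) (hμ : 0 < μ) (hlam : 0 < lam) {φ v : ℝ → ℝ}
    (hφc : Continuous φ) (hφ0 : ∀ y, 0 ≤ φ y) (hφ1 : (∫ y, φ y) = 1)
    (hva : v a = 0) (hvb : v b = 0)
    (hvc : ContinuousOn v (Set.Icc a b)) (hv2 : ContDiffOn ℝ 2 v (Set.Ioo a b))
    (heq : ∀ x ∈ Set.Ioo a b,
      -(σ ^ 2 / 2) * deriv (deriv v) x + μ * x * deriv v x - Iop a b lam φ v x = -(μ * x)) :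
    ∃ c ∈ Set.Ioo a b, ∃ m > 0, ∀ x ∈ Set.Ioo c b, m * (b - x) ≤ v x := by
  have hpos : ∀ x ∈ Set.Ioo a b, 0 < v x := by
    refine pos_of_no_nonpos_interior_min hvc hva.ge hvb.ge fun x hx hx0 hmin => ?_
    have hn := Icc_mem_nhds hx.1 hx.2
    have hloc : IsLocalMin v x := hmin.isLocalMin hn
    have h1 := hloc.deriv_eq_zero
    have h2 := hloc.deriv_deriv_nonneg (hvc.continuousAt hn)
    have h3 := le_intervalIntegral_mul_of_isMinOn hab hφc hφ0 hφ1 hvc hx0 hmin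
    have h4 := heq x hx
    rw [h1, Iop] at h4
    have h5 : 0 < μ * -x := mul_pos hμ (by linarith [hx.2])
    have h6 := mul_nonneg hlam.le (sub_nonneg.2 h3)
    have h7 : 0 ≤ σ ^ 2 / 2 * deriv (deriv v) x := by positivity
    linarith
  have hnonneg : ∀ y ∈ Set.Icc a b, 0 ≤ v y := by
    intro y hy
    rcases eq_or_lt_of_le hy.1 with h | h
    · rw [← h, hva]
    rcases eq_or_lt_of_le hy.2 with h' | h'
    · rw [h', hvb]
    exact (hpos y ⟨h, h'⟩).le
  obtain ⟨c, hc⟩ : (Set.Ioo a b).Nonempty := Set.nonempty_Ioo.2 hab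
  obtain ⟨k, hk1, hk⟩ : ∃ k : ℝ, 1 ≤ k ∧ -(μ * a) * k + lam < σ ^ 2 / 2 * k ^ 2 := by
    have ha : 0 < μ * -a := mul_pos hμ (by linarith)
    have hq : 0 ≤ 2 / σ ^ 2 * (μ * -a + lam) := by positivity
    refine ⟨1 + 2 / σ ^ 2 * (μ * -a + lam), by linarith, ?_⟩
    set k := 1 + 2 / σ ^ 2 * (μ * -a + lam) with hkdef
    have hk' : σ ^ 2 / 2 * k = σ ^ 2 / 2 + μ * -a + lam := by
      have hσ2 : σ ^ 2 * (2 / σ ^ 2) = 2 := by field_simp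
      rw [hkdef]
      linear_combination (μ * -a + lam) / 2 * hσ2
    have : σ ^ 2 / 2 * k ^ 2 = (σ ^ 2 / 2 + μ * -a + lam) * k := by rw [← hk']; ring
    rw [this]
    have hk1 : 1 ≤ k := by linarith
    have hs : 0 < σ ^ 2 / 2 * k := by positivity
    nlinarith
  have hk0 : 0 < k := by linarith
  have hE0 : 0 < Real.exp (k * (b - c)) - 1 := by
    have := Real.add_one_le_exp (k * (b - c))
    have := mul_pos hk0 (sub_pos.2 hc.2)
    linarith
  set ε := v c / (Real.exp (k * (b - c)) - 1) with hε
  have hε0 : 0 < ε := div_pos (hpos c hc) hE0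
  set w : ℝ → ℝ := fun x => ε * (Real.exp (k * (b - x)) - 1) with hw
  have hwc : w c = v c := by
    simp only [hw, hε]
    exact div_mul_cancel₀ _ hE0.ne'
  have hE : ∀ x, HasDerivAt (fun x => Real.exp (k * (b - x))) (-k * Real.exp (k * (b - x))) x := by
    intro x
    convert (((hasDerivAt_id' x).const_sub b).const_mul k).exp using 1
    ring
  have hw1 : ∀ x, HasDerivAt w (-(ε * k) * Real.exp (k * (b - x))) x := by
    intro x
    rw [show -(ε * k) * Real.exp (k * (b - x)) = ε * (-k * Real.exp (k * (b - x))) by ring]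
    exact ((hE x).sub_const 1).const_mul ε
  have hzpos : ∀ x ∈ Set.Ioo c b, 0 < v x - w x := by
    have hsub : Set.Icc c b ⊆ Set.Icc a b := Set.Icc_subset_Icc_left hc.1.le
    have hwcont : Continuous w := by fun_prop
    have hzc : ContinuousOn (fun x => v x - w x) (Set.Icc c b) :=
      (hvc.mono hsub).sub hwcont.continuousOn
    refine pos_of_no_nonpos_interior_min hzc (by simp [hwc]) (by simp [hw, hvb])
      fun x hx hx0 hmin => ?_
    have hn := Icc_mem_nhds hx.1 hx.2
    have hxab : x ∈ Set.Ioo a b := ⟨hc.1.trans hx.1, hx.2⟩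
    have hloc := hmin.isLocalMin hn
    have h1 := hloc.deriv_eq_zero
    have h2 := hloc.deriv_deriv_nonneg (hzc.continuousAt hn)
    have hd1 : ∀ y ∈ Set.Ioo a b, deriv (fun x => v x - w x) y
        = deriv v y - -(ε * k) * Real.exp (k * (b - y)) := fun y hy =>
      ((ContDiffOn.differentiableAt_and_deriv_of_Ioo hv2 hy).1.hasDerivAt.sub (hw1 y)).deriv
    have hd2 : deriv (deriv fun x => v x - w x) x
        = deriv (deriv v) x - -(ε * k) * (-k * Real.exp (k * (b - x))) := by
      have : deriv (fun x => v x - w x) =ᶠ[nhds x]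
          fun y => deriv v y - -(ε * k) * Real.exp (k * (b - y)) := by
        filter_upwards [isOpen_Ioo.mem_nhds hxab] with y hy using hd1 y hy
      rw [this.deriv_eq]
      exact ((ContDiffOn.differentiableAt_and_deriv_of_Ioo hv2 hxab).2.hasDerivAt.sub ((hE x).const_mul _)).deriv
    rw [hd1 x hxab] at h1
    rw [hd2] at h2
    have h4 := heq x hxab
    have hI : 0 ≤ ∫ y in a..b, φ (x - y) * v y :=
      intervalIntegral.integral_nonneg hab.le fun y hy => mul_nonneg (hφ0 _) (hnonneg y hy)
    have hI' := mul_nonneg hlam.le hI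
    rw [Iop] at h4
    have hx0' : v x ≤ ε * (Real.exp (k * (b - x)) - 1) := by simpa [hw] using hx0
    have hEp := Real.exp_pos (k * (b - x))
    set E := Real.exp (k * (b - x))
    have h5 : 0 < μ * -x := mul_pos hμ (by linarith [hx.2])
    have h6 : deriv v x = -(ε * k * E) := by linarith
    have h7 := mul_le_mul_of_nonneg_left hx0' hlam.le
    have h8 : 0 ≤ σ ^ 2 / 2 * (deriv (deriv v) x - -(ε * k) * (-k * E)) :=
      mul_nonneg (by positivity) h2
    have h9 : 0 < ε * E * (σ ^ 2 / 2 * k ^ 2 - (-(μ * a) * k + lam)) :=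
      mul_pos (mul_pos hε0 hEp) (sub_pos.2 hk)
    have h10 : 0 ≤ ε * E * (μ * k * (x - a)) :=
      mul_nonneg (by positivity) (mul_nonneg (by positivity) (by linarith [hxab.1]))
    have h11 := mul_pos hlam hε0
    rw [h6] at h4
    nlinarith
  refine ⟨c, hc, ε * k, mul_pos hε0 hk0, fun x hx => ?_⟩
  have h1 := hzpos x hx
  have h2 := mul_le_mul_of_nonneg_left (Real.add_one_le_exp (k * (b - x))) hε0.le
  simp only [hw] at h1
  nlinarith

lemma HasDerivWithinAt.neg_of_linear_lower_bound {v : ℝ → ℝ} {b c m d : ℝ} (hcb : c < b)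
    (hm : 0 < m) (hvb : v b = 0) (hlow : ∀ x ∈ Set.Ioo c b, m * (b - x) ≤ v x)
    (hd : HasDerivWithinAt v d (Set.Ioo c b) b) : d < 0 := by
  rw [hasDerivWithinAt_iff_tendsto_slope' (by simp)] at hd
  have : (nhdsWithin b (Set.Ioo c b)).NeBot := right_nhdsWithin_Ioo_neBot hcb
  have hle : d ≤ -m := by
    refine le_of_tendsto hd ?_
    filter_upwards [self_mem_nhdsWithin] with x hx
    rw [slope_def_field, hvb, div_le_iff_of_neg (by linarith [hx.2])]
    linarith [hlow x hx]
  linarith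

lemma integral_id_mul_eq_zero_of_even {φ : ℝ → ℝ} (hφ : ∀ y, φ (-y) = φ y) :
    (∫ y, y * φ y) = 0 := by
  have h := integral_neg_eq_self (fun y => y * φ y) volume
  simp only [hφ, neg_mul, integral_neg] at h
  linarith

/-- Subtracting the identity turns the free boundary problem into the boundary value problem. -/
lemma integral_sub_mul_eq_Iop {a b lam x : ℝ} (hab : a < b) {φ u : ℝ → ℝ}
    (hφc : Continuous φ) (hφcs : HasCompactSupport φ) (hφ1 : (∫ y, φ y) = 1)
    (hφsymm : ∀ y, φ (-y) = φ y) (hu : Continuous u) (hout : ∀ x, x ∉ Set.Ioo a b → u x = x) :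
    lam * (∫ y, (u (x + y) - u x) * φ y) = Iop a b lam φ (fun y => u y - y) x := by
  have hint : ∀ g : ℝ → ℝ, Continuous g → Integrable fun y => g y * φ y := fun g hg =>
    (hg.mul hφc).integrable_of_hasCompactSupport hφcs.mul_left
  have hsplit : (∫ y, (u (x + y) - u x) * φ y)
      = (∫ y, (u (x + y) - (x + y)) * φ y) - (u x - x) * (∫ y, φ y) + ∫ y, y * φ y := by
    have h1 := hint (fun y => u (x + y) - (x + y)) (by fun_prop)
    have h2 := hint (fun _ => u x - x) (by fun_prop)
    have h3 := hint (fun y => y) (by fun_prop)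
    rw [← integral_const_mul, ← integral_sub h1 h2]
    refine Eq.trans ?_ (integral_add (h1.sub h2) h3)
    congr 1; ext y; ring
  have hshift : (∫ y, (u (x + y) - (x + y)) * φ y) = ∫ y in a..b, φ (x - y) * (u y - y) := by
    rw [intervalIntegral.integral_of_le hab.le, setIntegral_eq_integral_of_forall_compl_eq_zero]
    · rw [← integral_add_left_eq_self (fun y => φ (x - y) * (u y - y)) x]
      congr 1; ext y
      rw [show x - (x + y) = -y by ring, hφsymm]; ring
    · intro y hy
      rw [hout y fun h => hy ⟨h.1, h.2.le⟩]; ring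
  rw [hsplit, hshift, integral_id_mul_eq_zero_of_even hφsymm, hφ1, Iop]
  ring

lemma continuous_of_eq_id_off_Ioo {a b : ℝ} {u : ℝ → ℝ}
    (hout : ∀ x, x ∉ Set.Ioo a b → u x = x) (hu : ContinuousOn u (Set.Icc a b)) :
    Continuous u := by
  have h : ContinuousOn u (Set.Icc a b ∪ (Set.Iic a ∪ Set.Ici b)) := by
    refine hu.union_of_isClosed (continuousOn_id.congr ?_) isClosed_Icc
      (isClosed_Iic.union isClosed_Ici)
    rintro x (hx | hx)
    · exact hout x fun h => absurd h.1 (not_lt.2 hx)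
    · exact hout x fun h => absurd h.2 (not_lt.2 hx)
  rw [← continuousOn_univ]
  refine h.mono fun x _ => ?_
  rcases le_total x a with h1 | h1
  · exact Or.inr (Or.inl h1)
  rcases le_total x b with h2 | h2
  · exact Or.inl ⟨h1, h2⟩
  · exact Or.inr (Or.inr h2)

/-- If `φ` is moreover symmetric with support in `(−J,J)` and `a < b ≤ 0`, then the
classical solution `v` of `𝓛v − 𝓘v = −μx` satisfies `v'(b) < 0`. In particular, if
`(u, b*)` with `b* > a` solves the free boundary problem, then `b* > 0`. -/
theorem stmt18 (a σ μ lam J : ℝ) (hσ : 0 < σ) (hμ : 0 < μ) (hlam : 0 < lam) (hJ : 0 < J)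
    (φ : ℝ → ℝ) (hφc : Continuous φ) (hφ0 : ∀ y, 0 ≤ φ y) (hφ1 : (∫ y, φ y) = 1)
    (hφsymm : ∀ y, φ (-y) = φ y) (hφsupp : ∀ y, φ y ≠ 0 → y ∈ Set.Ioo (-J) J) :
    (∀ b : ℝ, a < b → b ≤ 0 →
      ∀ v : ℝ → ℝ, IsClassicalSolution a b σ μ lam φ (fun x => -(μ * x)) v →
        derivWithin v (Set.Icc a b) b < 0) ∧
    (∀ b' : ℝ, a < b' →
      ∀ u : ℝ → ℝ,
        (∀ x, x ∉ Set.Ioo a b' → u x = x) →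
        ContinuousOn u (Set.Icc a b') →
        ContDiffOn ℝ 2 u (Set.Ioo a b') →
        (∀ x ∈ Set.Ioo a b',
          (σ ^ 2 / 2) * deriv (deriv u) x - μ * x * deriv u x +
            lam * ∫ y, (u (x + y) - u x) * φ y = 0) →
        derivWithin u (Set.Iic b') b' = 1 →
        0 < b') := by
  constructor
  · rintro b hab hb v ⟨hout, hv2, heq⟩
    have hvb : v b = 0 := hout b (by simp)
    obtain ⟨c, hc, m, hm, hlow⟩ := exists_linear_lower_bound hab hb hσ hμ hlam hφc hφ0 hφ1
      (hout a (by simp)) hvb hv2.continuousOn (hv2.mono Set.Ioo_subset_Icc_self) heq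
    have hd := (hv2.differentiableOn (by norm_num) b
      (Set.right_mem_Icc.2 hab.le)).hasDerivWithinAt
    exact (hd.mono ((Set.Ioo_subset_Ioo_left hc.1.le).trans
      Set.Ioo_subset_Icc_self)).neg_of_linear_lower_bound hc.2 hm hvb hlow
  · intro b hab u hout huc hu2 heq hd1
    by_contra! hb
    have hucont := continuous_of_eq_id_off_Ioo hout huc
    have hφcs : HasCompactSupport φ :=
      HasCompactSupport.of_support_subset_isCompact (isCompact_Icc (a := -J) (b := J))
        fun y hy => Set.Ioo_subset_Icc_self (hφsupp y hy)
    have hub : u b - b = 0 := by rw [hout b (by simp)]; ring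
    have hD : ∀ y ∈ Set.Ioo a b, deriv (fun y => u y - y) y = deriv u y - 1 := fun y hy =>
      ((ContDiffOn.differentiableAt_and_deriv_of_Ioo hu2 hy).1.hasDerivAt.sub (hasDerivAt_id y)).deriv
    obtain ⟨c, hc, m, hm, hlow⟩ := exists_linear_lower_bound (v := fun y => u y - y) hab hb hσ hμ
      hlam hφc hφ0 hφ1 (by rw [hout a (by simp)]; ring) hub
      (huc.sub continuousOn_id) (hu2.sub contDiffOn_id) (by
        intro x hx
        have hDD : deriv (deriv fun y => u y - y) x = deriv (deriv u) x := by
          have : deriv (fun y => u y - y) =ᶠ[nhds x] fun y => deriv u y - 1 := by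
            filter_upwards [isOpen_Ioo.mem_nhds hx] with y hy using hD y hy
          rw [this.deriv_eq, deriv_sub_const]
        have h := heq x hx
        rw [integral_sub_mul_eq_Iop hab hφc hφcs hφ1 hφsymm hucont hout] at h
        rw [hDD, hD x hx]
        linarith)
    have hdiff : DifferentiableWithinAt ℝ u (Set.Iic b) b := by
      by_contra h
      rw [derivWithin_zero_of_not_differentiableWithinAt h] at hd1
      norm_num at hd1
    have hd := hdiff.hasDerivWithinAt
    rw [hd1] at hd
    have hneg := HasDerivWithinAt.neg_of_linear_lower_bound (v := fun y => u y - y) hc.2 hm hub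
      hlow ((hd.sub (hasDerivWithinAt_id b _)).mono fun x (hx : x ∈ Set.Ioo c b) => hx.2.le)
    norm_num at hneg
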